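/- Let n ≥ 2. Let e_i ∈ ℝ^n denote the vector with all coordinates 0 except the i-th, which is 1 (i = 1, …, n−1), put e_0 = e_1 + … + e_{n−1}, and set T = {e_i : i = 1, …, n−1} ∪ {−e_i : i = 1, …, n−1} ∪ {e_0, −e_0}. Further set H = {x ∈ ℝ^n : x_n = 0 and |x|_C ≤ 1}, where x_n is the last coordinate of x. Then H equals the convex hull of T. -/

import Mathlib

/-- The nondecreasing rearrangement of a tuple. -/
noncomputable def sortedVec {n : ℕ} (x : Fin n → ℝ) : Fin n → ℝ := x ∘ Tuple.sort x

/-- The center of a tuple `x`: its lower median, i.e. the value `y_l` with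
`l = ⌊(n+1)/2⌋` (1-indexed) in the nondecreasing rearrangement `y_1 ≤ … ≤ y_n` of `x`. -/
noncomputable def center {n : ℕ} (x : Fin n → ℝ) : ℝ :=
  if h : 0 < n then
    sortedVec x ⟨(n - 1) / 2, lt_of_le_of_lt (Nat.div_le_self _ _) (Nat.sub_lt h one_pos)⟩
  else 0

/-- The central norm `|x|_C = ∑_{i=1}^n |y_l - y_i|`. -/
noncomputable def centralNorm {n : ℕ} (x : Fin n → ℝ) : ℝ :=
  ∑ i, |center x - sortedVec x i|

/-- Row norm `‖A‖ = max_i ∑_j |a_{ij}|` of a real matrix. -/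
noncomputable def rowNorm {m n : ℕ} (A : Matrix (Fin m) (Fin n) ℝ) : ℝ :=
  ⨆ i, ∑ j, |A i j|

/-- `N(M)`: the infimum (in fact minimum) of the row norms of left inverses of `M`. -/
noncomputable def Nnorm {m n : ℕ} (M : Matrix (Fin m) (Fin n) ℝ) : ℝ :=
  sInf (rowNorm '' {M' : Matrix (Fin n) (Fin m) ℝ | M' * M = 1})

/-- Centralization of a row vector: subtract the center from each entry. -/
noncomputable def centralize {n : ℕ} (x : Fin n → ℝ) : Fin n → ℝ :=
  fun j => x j - center x

/-- Row-wise centralization of a matrix. -/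
noncomputable def matCentralize {m n : ℕ} (B : Matrix (Fin m) (Fin n) ℝ) :
    Matrix (Fin m) (Fin n) ℝ :=
  Matrix.of fun i => centralize (B i)

theorem centralNorm_eq {n : ℕ} (x : Fin n → ℝ) :
    centralNorm x = ∑ i, |center x - x i| := by
  unfold centralNorm sortedVec
  exact Equiv.sum_comp (Tuple.sort x) (fun i => |center x - x i|)

theorem centralNorm_le {n : ℕ} (x : Fin n → ℝ) (c : ℝ) :
    centralNorm x ≤ ∑ i, |c - x i| := by
  have h1 : ∑ i, |c - x i| = ∑ i, |c - sortedVec x i| :=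
    (Equiv.sum_comp (Tuple.sort x) (fun i => |c - x i|)).symm
  have hm : Monotone (sortedVec x) := Tuple.monotone_sort x
  have key : ∀ d : ℝ, ∑ i, (|d - sortedVec x i| + |d - sortedVec x (Fin.rev i)|)
      = 2 * ∑ i, |d - sortedVec x i| := by
    intro d
    rw [Finset.sum_add_distrib]
    have := Equiv.sum_comp Fin.revPerm (fun i => |d - sortedVec x i|)
    simp only [Fin.revPerm_apply] at this
    rw [this]; ring
  have h2 : ∑ i, (|center x - sortedVec x i| + |center x - sortedVec x (Fin.rev i)|)
      ≤ ∑ i, (|c - sortedVec x i| + |c - sortedVec x (Fin.rev i)|) := by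
    apply Finset.sum_le_sum
    intro i _
    have hn : 0 < n := i.pos
    have hc : center x = sortedVec x ⟨(n - 1) / 2,
      lt_of_le_of_lt (Nat.div_le_self _ _) (Nat.sub_lt hn one_pos)⟩ := by
      simp [center, hn]
    have hi := i.isLt
    have hb : (sortedVec x i ≤ center x ∧ center x ≤ sortedVec x (Fin.rev i)) ∨
        (sortedVec x (Fin.rev i) ≤ center x ∧ center x ≤ sortedVec x i) := by
      rw [hc]
      by_cases h : (i : ℕ) ≤ (n - 1) / 2
      · left
        constructor <;> apply hm <;> rw [Fin.le_def] <;> simp only [Fin.val_rev] <;> omega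
      · right
        constructor <;> apply hm <;> rw [Fin.le_def] <;> simp only [Fin.val_rev] <;> omega
    generalize sortedVec x i = a at *
    generalize sortedVec x (Fin.rev i) = b at *
    generalize center x = m at *
    rcases hb with ⟨h, h'⟩ | ⟨h, h'⟩
    · rw [abs_of_nonneg (sub_nonneg.2 h), abs_of_nonpos (sub_nonpos.2 h')]
      linarith [le_abs_self (c - a), neg_abs_le (c - b)]
    · rw [abs_of_nonpos (sub_nonpos.2 h'), abs_of_nonneg (sub_nonneg.2 h)]
      linarith [le_abs_self (c - b), neg_abs_le (c - a)]
  rw [key, key] at h2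
  rw [h1]
  unfold centralNorm
  linarith

theorem sum_mem_of_symm {E ι : Type*} [AddCommGroup E] [Module ℝ E] [Fintype ι] {S : Set E}
    (hS : Convex ℝ S) (h0 : (0 : E) ∈ S) (w : ι → ℝ) (v : ι → E)
    (hv : ∀ i, v i ∈ S ∧ -v i ∈ S) (hw : ∑ i, |w i| ≤ 1) : ∑ i, w i • v i ∈ S := by
  classical
  have := hS.sum_mem (t := (Finset.univ : Finset (Option ι)))
    (w := fun o => o.elim (1 - ∑ i, |w i|) (fun i => |w i|))
    (z := fun o => o.elim 0 (fun i => if 0 ≤ w i then v i else -v i)) ?_ ?_ ?_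
  · rw [Fintype.sum_option] at this
    simp only [Option.elim, smul_zero, zero_add] at this
    convert this using 2 with i
    split_ifs with h
    · rw [abs_of_nonneg h]
    · rw [abs_of_neg (not_le.1 h)]; simp
  · rintro (_ | i) _
    · simpa using hw
    · simp
  · rw [Fintype.sum_option]; simp
  · rintro (_ | i) _
    · exact h0
    · simp only [Option.elim]
      split_ifs
      · exact (hv i).1
      · exact (hv i).2

theorem e_zero_apply {n : ℕ} (j : Fin n) :
    (∑ i ∈ Finset.univ.filter (fun i : Fin n => (i : ℕ) < n - 1),
      (Pi.single i (1 : ℝ) : Fin n → ℝ)) j = if (j : ℕ) < n - 1 then 1 else 0 := by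
  rw [Finset.sum_apply]
  simp [Pi.single_apply, Finset.sum_ite_eq]

/-- Lemma 2: for `n ≥ 2`, the set `H = {x ∈ ℝⁿ : xₙ = 0, |x|_C ≤ 1}` is the convex hull
of `T = {±e₁, …, ±e_{n-1}, ±e₀}` where `e₀ = e₁ + ⋯ + e_{n-1}`. -/
theorem stmt8 (n : ℕ) (hn : 2 ≤ n) :
    {x : Fin n → ℝ | x ⟨n - 1, by omega⟩ = 0 ∧ centralNorm x ≤ 1} =
      convexHull ℝ
        ({v : Fin n → ℝ | ∃ i : Fin n, (i : ℕ) < n - 1 ∧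
            (v = Pi.single i 1 ∨ v = -Pi.single i 1)} ∪
          {v : Fin n → ℝ |
            v = ∑ i ∈ Finset.univ.filter (fun i : Fin n => (i : ℕ) < n - 1),
                  Pi.single i (1 : ℝ) ∨
            v = -∑ i ∈ Finset.univ.filter (fun i : Fin n => (i : ℕ) < n - 1),
                  Pi.single i (1 : ℝ)}) := by
  have hlast : ∀ j : Fin n, ¬ (j : ℕ) < n - 1 ↔ j = ⟨n - 1, by omega⟩ := by
    intro j
    rw [Fin.ext_iff]
    have := j.isLt
    simp only
    omega
  apply Set.Subset.antisymm
  · rintro x ⟨hx0, hx⟩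
    rw [centralNorm_eq] at hx
    set T := ({v : Fin n → ℝ | ∃ i : Fin n, (i : ℕ) < n - 1 ∧
            (v = Pi.single i 1 ∨ v = -Pi.single i 1)} ∪
          {v : Fin n → ℝ |
            v = ∑ i ∈ Finset.univ.filter (fun i : Fin n => (i : ℕ) < n - 1),
                  Pi.single i (1 : ℝ) ∨
            v = -∑ i ∈ Finset.univ.filter (fun i : Fin n => (i : ℕ) < n - 1),
                  Pi.single i (1 : ℝ)}) with hT
    set e0 : Fin n → ℝ := ∑ i ∈ Finset.univ.filter (fun i : Fin n => (i : ℕ) < n - 1),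
                  Pi.single i (1 : ℝ) with he0
    have hS : Convex ℝ (convexHull ℝ T) := convex_convexHull ℝ T
    have hp : e0 ∈ convexHull ℝ T := subset_convexHull ℝ T (Or.inr (Or.inl rfl))
    have hq : -e0 ∈ convexHull ℝ T := subset_convexHull ℝ T (Or.inr (Or.inr rfl))
    have h0 : (0 : Fin n → ℝ) ∈ convexHull ℝ T := by
      have := hS hp hq (a := 1/2) (b := 1/2) (by norm_num) (by norm_num) (by norm_num)
      simpa using this
    have := sum_mem_of_symm hS h0 (fun i => x i - center x)
      (fun i => if (i : ℕ) < n - 1 then Pi.single i 1 else -e0) ?_ ?_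
    · convert this using 1
      ext j
      have hsplit : ∀ i : Fin n, ((x i - center x) •
          (if (i : ℕ) < n - 1 then Pi.single i 1 else -e0 : Fin n → ℝ)) j =
          (if i = j then (if (j : ℕ) < n - 1 then x j - center x else 0) else 0) +
          (if i = ⟨n - 1, by omega⟩ then center x * e0 j else 0) := by
        intro i
        by_cases hi : (i : ℕ) < n - 1
        · have h2 : i ≠ ⟨n - 1, by omega⟩ := fun h => (hlast i).2 h hi
          by_cases hij : i = j
          · subst hij; simp [hi, h2]
          · simp [hi, h2, hij, Ne.symm hij]
        · have h2 := (hlast i).1 hi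
          by_cases hij : i = j
          · subst hij
            simp [hi, ← h2]
            rw [h2, hx0]; ring
          · simp only [hi, hij, if_false, h2]
            simp [hx0]
            intro h _
            exact absurd (h2.trans h) hij
      rw [Finset.sum_apply, Finset.sum_congr rfl (fun i _ => hsplit i), Finset.sum_add_distrib]
      simp only [Finset.sum_ite_eq', Finset.mem_univ, if_true]
      rw [he0, e_zero_apply]
      split_ifs with h
      · ring
      · rw [(hlast j).1 h, hx0]; ring
    · intro i
      split_ifs with h
      · exact ⟨subset_convexHull ℝ T (Or.inl ⟨i, h, Or.inl rfl⟩),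
          subset_convexHull ℝ T (Or.inl ⟨i, h, Or.inr rfl⟩)⟩
      · exact ⟨hq, by rwa [neg_neg]⟩
    · refine le_trans (le_of_eq ?_) hx
      exact Finset.sum_congr rfl (fun i _ => abs_sub_comm _ _)
  · apply convexHull_min
    · have hsum1 : ∀ i : Fin n, ∑ j, |(Pi.single i (1 : ℝ) : Fin n → ℝ) j| = 1 := by
        intro i
        rw [Finset.sum_eq_single i]
        · simp
        · intro j _ hj; simp [hj]
        · simp
      have hsum2 : ∑ j : Fin n, |(1 : ℝ) - if (j : ℕ) < n - 1 then 1 else 0| = 1 := by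
        rw [Finset.sum_eq_single (⟨n - 1, by omega⟩ : Fin n)]
        · simp
        · intro j _ hj
          have : (j : ℕ) < n - 1 := by
            by_contra h
            exact hj ((hlast j).1 h)
          simp [this]
        · simp
      rintro v (⟨i, hi, rfl | rfl⟩ | rfl | rfl)
      · have h2 : (⟨n - 1, by omega⟩ : Fin n) ≠ i := fun h => (hlast i).2 h.symm hi
        refine ⟨by simp [h2], (centralNorm_le _ 0).trans (le_of_eq ?_)⟩
        refine Eq.trans ?_ (hsum1 i)
        exact Finset.sum_congr rfl (fun j _ => by rw [zero_sub, abs_neg])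
      · have h2 : (⟨n - 1, by omega⟩ : Fin n) ≠ i := fun h => (hlast i).2 h.symm hi
        refine ⟨by simp [h2], (centralNorm_le _ 0).trans (le_of_eq ?_)⟩
        refine Eq.trans ?_ (hsum1 i)
        exact Finset.sum_congr rfl (fun j _ => by rw [zero_sub, Pi.neg_apply, neg_neg])
      · refine ⟨by rw [e_zero_apply]; simp, (centralNorm_le _ 1).trans (le_of_eq ?_)⟩
        refine Eq.trans ?_ hsum2
        exact Finset.sum_congr rfl (fun j _ => by rw [e_zero_apply])
      · refine ⟨by rw [Pi.neg_apply, e_zero_apply]; simp,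
          (centralNorm_le _ (-1)).trans (le_of_eq ?_)⟩
        refine Eq.trans ?_ hsum2
        refine Finset.sum_congr rfl (fun j _ => ?_)
        rw [Pi.neg_apply, e_zero_apply, ← abs_neg]
        congr 1
        ring
    · rintro x ⟨hx0, hx⟩ y ⟨hy0, hy⟩ a b ha hb hab
      refine ⟨by simp [hx0, hy0], ?_⟩
      rw [centralNorm_eq] at hx hy
      calc centralNorm (a • x + b • y)
          ≤ ∑ i, |(a * center x + b * center y) - (a • x + b • y) i| := centralNorm_le _ _
        _ ≤ ∑ i, (a * |center x - x i| + b * |center y - y i|) := by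
            apply Finset.sum_le_sum
            intro i _
            rw [← abs_of_nonneg ha, ← abs_of_nonneg hb, ← abs_mul, ← abs_mul,
              abs_of_nonneg ha, abs_of_nonneg hb]
            refine le_trans (le_of_eq ?_) (abs_add_le _ _)
            congr 1
            simp only [Pi.add_apply, Pi.smul_apply, smul_eq_mul]
            ring
        _ = a * ∑ i, |center x - x i| + b * ∑ i, |center y - y i| := by
            rw [Finset.sum_add_distrib, Finset.mul_sum, Finset.mul_sum]
        _ ≤ 1 := by nlinarith
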